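/- arXiv:1107.4142 — 2 statements merged into one kernel-verified Lean document; each statement's English description precedes it below -/
import Mathlib

section
/- Under assumptions (A1)–(A3), there exists a constant C_2 < ∞ such that for every ε > 0 there is a δ ∈ (0, ε) with the property: for all ν, ξ ∈ M_1(Z), ρ_0(ν,ξ) < δ implies S_ε(ξ|ν) ≤ C_2 ε. -/
open MeasureTheory Set ENNReal Filter

noncomputable section

/-- The Legendre conjugate `τ*(u) = (u+1)·log(u+1) − u`.  Since `Real.log 0 = 0`
in Mathlib, this gives `τ*(-1) = 1`, matching the convention of the paper; the
value for `u < -1` is irrelevant since all arguments below are `≥ -1`. -/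
def tauStar (u : ℝ) : ℝ := (u + 1) * Real.log (u + 1) - u

/-- The mean field model: state space `Fin r`, directed edge set `E` without
self-loops, and transition rate functions `lam i j`, together with assumptions
(A1) (irreducibility), (A2) (Lipschitz rates) and (A3) (rates on edges bounded
below by `c > 0`); `Cb` is the upper bound on the rates (a consequence of
(A2) and compactness of the simplex). -/
structure MeanFieldModel (r : ℕ) where
  E : Finset (Fin r × Fin r)
  no_diag : ∀ i : Fin r, (i, i) ∉ E
  /-- (A1): the directed graph `(Z, E)` is irreducible. -/
  irreducible : ∀ i j : Fin r, Relation.ReflTransGen (fun a b => (a, b) ∈ E) i j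
  lam : Fin r → Fin r → (Fin r → ℝ) → ℝ
  /-- (A2): each rate function is Lipschitz on the simplex. -/
  lam_lipschitz : ∀ p ∈ E, ∃ K : NNReal, LipschitzOnWith K (lam p.1 p.2) (stdSimplex ℝ (Fin r))
  c : ℝ
  c_pos : 0 < c
  /-- (A3): rates of admissible jumps are uniformly bounded away from zero. -/
  lam_lower : ∀ p ∈ E, ∀ μ ∈ stdSimplex ℝ (Fin r), c ≤ lam p.1 p.2 μ
  /-- rates vanish off the edge set -/
  lam_off : ∀ i j : Fin r, i ≠ j → (i, j) ∉ E → ∀ μ : Fin r → ℝ, lam i j μ = 0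
  /-- diagonal convention `λ_{i,i} = −Σ_{j≠i} λ_{i,j}` -/
  lam_diag : ∀ i : Fin r, ∀ μ : Fin r → ℝ,
    lam i i μ = -∑ j ∈ Finset.univ.filter (fun j => j ≠ i), lam i j μ
  Cb : ℝ
  /-- upper bound on the rates -/
  lam_upper : ∀ p ∈ E, ∀ μ ∈ stdSimplex ℝ (Fin r), lam p.1 p.2 μ ≤ Cb

variable {r : ℕ}

/-- A time-varying rate matrix `L(t)` adapted to the model: measurable entries,
nonnegative off-diagonal entries, entries vanishing off the edge set, and the
diagonal convention `l_{i,i}(t) = −Σ_{j≠i} l_{i,j}(t)`. -/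
def IsRateMatrix (M : MeanFieldModel r) (L : ℝ → Fin r → Fin r → ℝ) : Prop :=
  (∀ i j : Fin r, Measurable fun t => L t i j) ∧
  (∀ t : ℝ, ∀ i j : Fin r, i ≠ j → 0 ≤ L t i j) ∧
  (∀ t : ℝ, ∀ i j : Fin r, i ≠ j → (i, j) ∉ M.E → L t i j = 0) ∧
  (∀ t : ℝ, ∀ i : Fin r,
    L t i i = -∑ j ∈ Finset.univ.filter (fun j => j ≠ i), L t i j)

/-- `μ` is absolutely continuous on `[0,T]` with `μ̇(t) = L(t)ᵀ μ(t)` a.e.,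
expressed in integral form:  `μ(t) = μ(0) + ∫_0^t L(s)ᵀ μ(s) ds`. -/
def SolvesODE (L : ℝ → Fin r → Fin r → ℝ) (μ : ℝ → Fin r → ℝ) (T : ℝ) : Prop :=
  (∀ i : Fin r, IntegrableOn (fun t => ∑ j, L t j i * μ t j) (Icc 0 T)) ∧
  ∀ t ∈ Icc (0 : ℝ) T, ∀ i : Fin r,
    μ t i = μ 0 i + ∫ s in Ioc (0 : ℝ) t, ∑ j, L s j i * μ s j

/-- `μ` is absolutely continuous on `[0,∞)` with `μ̇(t) = −L(t)ᵀ μ(t)` a.e.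
(reversed-time dynamics), in integral form. -/
def SolvesReversedODE (L : ℝ → Fin r → Fin r → ℝ) (μ : ℝ → Fin r → ℝ) : Prop :=
  (∀ T : ℝ, 0 < T → ∀ i : Fin r,
    IntegrableOn (fun t => ∑ j, L t j i * μ t j) (Icc 0 T)) ∧
  ∀ t : ℝ, 0 ≤ t → ∀ i : Fin r,
    μ t i = μ 0 i - ∫ s in Ioc (0 : ℝ) t, ∑ j, L s j i * μ s j

/-- The running cost
`I_{[0,T]}(μ, L) = ∫_0^T Σ_{(i,j)∈E} μ(t)(i) λ_{i,j}(μ(t)) τ*( l_{i,j}(t)/λ_{i,j}(μ(t)) − 1 ) dt`. -/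
def runningCost (M : MeanFieldModel r) (μ : ℝ → Fin r → ℝ)
    (L : ℝ → Fin r → Fin r → ℝ) (T : ℝ) : ℝ≥0∞ :=
  ∫⁻ t in Ioc (0 : ℝ) T, ENNReal.ofReal (∑ p ∈ M.E,
    μ t p.1 * M.lam p.1 p.2 (μ t) * tauStar (L t p.1 p.2 / M.lam p.1 p.2 (μ t) - 1))

/-- The infinite-horizon running cost on `[0, ∞)`. -/
def runningCostInf (M : MeanFieldModel r) (μ : ℝ → Fin r → ℝ)
    (L : ℝ → Fin r → Fin r → ℝ) : ℝ≥0∞ :=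
  ∫⁻ t in Ioi (0 : ℝ), ENNReal.ofReal (∑ p ∈ M.E,
    μ t p.1 * M.lam p.1 p.2 (μ t) * tauStar (L t p.1 p.2 / M.lam p.1 p.2 (μ t) - 1))

/-- `S_{[0,T]}(μ | ν)`: the infimum of the running cost over all time-varying
rate matrices `L` with `μ̇ = Lᵀ μ` a.e., provided `μ(0) = ν`, `μ` is absolutely
continuous and takes values in `M₁(Z)`; `+∞` otherwise (the infimum over an
empty family being `⊤`). -/
def SPath (M : MeanFieldModel r) (T : ℝ) (ν : Fin r → ℝ) (μ : ℝ → Fin r → ℝ) : ℝ≥0∞ :=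
  ⨅ (L : ℝ → Fin r → Fin r → ℝ)
    (_ : IsRateMatrix M L ∧ SolvesODE L μ T ∧ μ 0 = ν ∧
      ∀ t ∈ Icc (0 : ℝ) T, μ t ∈ stdSimplex ℝ (Fin r)),
    runningCost M μ L T

/-- `S_T(ξ | ν) = inf { S_{[0,T]}(μ|ν) : μ(0) = ν, μ(T) = ξ }`. -/
def SEnd (M : MeanFieldModel r) (T : ℝ) (ν ξ : Fin r → ℝ) : ℝ≥0∞ :=
  ⨅ (μ : ℝ → Fin r → ℝ) (_ : μ 0 = ν ∧ μ T = ξ), SPath M T ν μ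

/-- The quasipotential `V(ξ | ν) = inf_{T > 0} S_T(ξ | ν)`. -/
def quasipotential (M : MeanFieldModel r) (ν ξ : Fin r → ℝ) : ℝ≥0∞ :=
  ⨅ (T : ℝ) (_ : 0 < T), SEnd M T ν ξ

/-- Equivalence of points: `ν ∼ ξ` iff `V(ξ|ν) = V(ν|ξ) = 0`. -/
def VEquiv (M : MeanFieldModel r) (ν ξ : Fin r → ℝ) : Prop :=
  quasipotential M ν ξ = 0 ∧ quasipotential M ξ ν = 0

/-- `s` satisfies the dynamic programming equation
`s(ξ) = inf_{ν ∈ M₁(Z)} [ s(ν) + S_T(ξ|ν) ]` for every `T > 0`. -/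
def SatisfiesDPE (M : MeanFieldModel r) (s : (Fin r → ℝ) → ℝ) : Prop :=
  ∀ T : ℝ, 0 < T → ∀ ξ ∈ stdSimplex ℝ (Fin r),
    ENNReal.ofReal (s ξ) =
      ⨅ ν ∈ stdSimplex ℝ (Fin r), (ENNReal.ofReal (s ν) + SEnd M T ν ξ)

/-- A solution of the McKean–Vlasov equation `μ̇(t) = A_{μ(t)}ᵀ μ(t)` on `[0,∞)`,
as a path in `M₁(Z)`, in integral form. -/
def IsMVSolution (M : MeanFieldModel r) (η : ℝ → Fin r → ℝ) : Prop :=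
  (∀ t : ℝ, 0 ≤ t → η t ∈ stdSimplex ℝ (Fin r)) ∧
  (∀ T : ℝ, 0 < T → ∀ i : Fin r,
    IntegrableOn (fun t => ∑ j, M.lam j i (η t) * η t j) (Icc 0 T)) ∧
  ∀ t : ℝ, 0 ≤ t → ∀ i : Fin r,
    η t i = η 0 i + ∫ s in Ioc (0 : ℝ) t, ∑ j, M.lam j i (η s) * η s j

/-- A solution of the time-reversed McKean–Vlasov equation
`η̇(t) = −A_{η(t)}ᵀ η(t)` on `[0,∞)`, in integral form. -/
def IsReversedMVSolution (M : MeanFieldModel r) (η : ℝ → Fin r → ℝ) : Prop :=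
  (∀ T : ℝ, 0 < T → ∀ i : Fin r,
    IntegrableOn (fun t => ∑ j, M.lam j i (η t) * η t j) (Icc 0 T)) ∧
  ∀ t : ℝ, 0 ≤ t → ∀ i : Fin r,
    η t i = η 0 i - ∫ s in Ioc (0 : ℝ) t, ∑ j, M.lam j i (η s) * η s j

/-- `ξ₀` is the unique globally asymptotically stable equilibrium of the
McKean–Vlasov equation: `A_{ξ₀}ᵀ ξ₀ = 0` and every solution with initial
condition in `M₁(Z)` converges to `ξ₀`. -/
def IsUniqueGASEquilibrium (M : MeanFieldModel r) (ξ₀ : Fin r → ℝ) : Prop :=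
  ξ₀ ∈ stdSimplex ℝ (Fin r) ∧
  (∀ i : Fin r, ∑ j, M.lam j i ξ₀ * ξ₀ j = 0) ∧
  ∀ η : ℝ → Fin r → ℝ, IsMVSolution M η → Tendsto η atTop (nhds ξ₀)

/-- The ω-limit set of a path: `Ω = ∩_{t>0} closure { μ(t') : t' ≥ t }`. -/
def omegaSet (η : ℝ → Fin r → ℝ) : Set (Fin r → ℝ) :=
  ⋂ t ∈ Ioi (0 : ℝ), closure (η '' Ici t)

/-- Assumption (B): finitely many compact subsets `K 1, …, K l` of `M₁(Z)` such
that any two points of the same `K i` are equivalent, no point of `K i` is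
equivalent to a point of `M₁(Z)` outside `K i`, and every ω-limit set of the
McKean–Vlasov equation is contained in some `K i`. -/
def AssumptionB (M : MeanFieldModel r) (l : ℕ) (K : Fin l → Set (Fin r → ℝ)) : Prop :=
  (∀ i, IsCompact (K i)) ∧
  (∀ i, K i ⊆ stdSimplex ℝ (Fin r)) ∧
  (∀ i, ∀ ν ∈ K i, ∀ ξ ∈ K i, VEquiv M ν ξ) ∧
  (∀ i, ∀ ν ∈ K i, ∀ ξ ∈ stdSimplex ℝ (Fin r), ξ ∉ K i → ¬ VEquiv M ν ξ) ∧
  (∀ η : ℝ → Fin r → ℝ, IsMVSolution M η → ∃ i, omegaSet η ⊆ K i)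

/-- `μ` is continuous and piecewise linear on `[0,T]`, with constant velocity on
each linear segment (linear interpolation between the breakpoints). -/
def PiecewiseLinear (μ : ℝ → Fin r → ℝ) (T : ℝ) : Prop :=
  ∃ (n : ℕ) (t : Fin (n + 1) → ℝ), StrictMono t ∧ t 0 = 0 ∧ t (Fin.last n) = T ∧
    ∀ k : Fin n, ∀ u ∈ Icc (t k.castSucc) (t k.succ), ∀ i : Fin r,
      μ u i = μ (t k.castSucc) i +
        (u - t k.castSucc) / (t k.succ - t k.castSucc) *
          (μ (t k.succ) i - μ (t k.castSucc) i)

end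

section Helpers

variable {r : ℕ}

lemma exists_unit_flow (M : MeanFieldModel r) (a b : Fin r) :
    ∃ φ : Fin r → Fin r → ℝ, (∀ i j, 0 ≤ φ i j) ∧ (∀ i j, (i, j) ∉ M.E → φ i j = 0) ∧
      ∀ i, ∑ j, φ j i - ∑ j, φ i j = (if i = b then 1 else 0) - (if i = a then 1 else 0) := by
  have h := M.irreducible a b
  induction h with
  | refl => exact ⟨fun _ _ => 0, by simp, by simp, by simp⟩
  | @tail b c _ hbc ih =>
    obtain ⟨φ, h1, h2, h3⟩ := ih
    refine ⟨fun i j => φ i j + (if i = b then 1 else 0) * (if j = c then 1 else 0), ?_, ?_, ?_⟩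
    · intro i j
      have := h1 i j
      positivity
    · intro i j hij
      have := h2 i j hij
      by_cases hi : i = b
      · by_cases hj : j = c
        · subst hi hj; exact absurd hbc hij
        · simp [this, hj]
      · simp [this, hi]
    · intro i
      have := h3 i
      simp only [Finset.sum_add_distrib, ← Finset.sum_mul, ← Finset.mul_sum]
      simp only [Finset.sum_ite_eq', Finset.mem_univ, if_true]
      linarith

lemma exists_flow (hr : 0 < r) (M : MeanFieldModel r) :
    ∃ (K : ℝ) (F : (Fin r → ℝ) → Fin r → Fin r → ℝ), 0 ≤ K ∧
      (∀ i j, Continuous fun v => F v i j) ∧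
      (∀ v i j, 0 ≤ F v i j) ∧ (∀ v i j, (i, j) ∉ M.E → F v i j = 0) ∧
      (∀ v B, (∀ b, |v b| ≤ B) → ∀ i j, F v i j ≤ K * B) ∧
      ∀ v, ∑ b, v b = 0 → ∀ i, ∑ j, F v j i - ∑ j, F v i j = v i := by
  choose φ h1 h2 h3 using exists_unit_flow M
  let o : Fin r := ⟨0, hr⟩
  refine ⟨∑ b, ∑ i, ∑ j, (φ o b i j + φ b o i j),
    fun v i j => ∑ b, (max (v b) 0 * φ o b i j + max (-v b) 0 * φ b o i j), ?_, ?_, ?_, ?_, ?_, ?_⟩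
  · exact Finset.sum_nonneg fun b _ => Finset.sum_nonneg fun i _ => Finset.sum_nonneg fun j _ =>
      add_nonneg (h1 _ _ _ _) (h1 _ _ _ _)
  · intro i j
    fun_prop
  · intro v i j
    exact Finset.sum_nonneg fun b _ => add_nonneg (mul_nonneg (le_max_right _ _) (h1 _ _ _ _))
      (mul_nonneg (le_max_right _ _) (h1 _ _ _ _))
  · intro v i j hij
    simp [h2 _ _ i j hij]
  · intro v B hB i j
    rw [Finset.sum_mul]
    refine Finset.sum_le_sum fun b _ => ?_
    have hb := abs_le.1 (hB b)
    have hB0 : 0 ≤ B := (abs_nonneg _).trans (hB b)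
    have e1 : max (v b) 0 * φ o b i j ≤ B * φ o b i j :=
      mul_le_mul_of_nonneg_right (max_le hb.2 hB0) (h1 _ _ _ _)
    have e2 : max (-v b) 0 * φ b o i j ≤ B * φ b o i j :=
      mul_le_mul_of_nonneg_right (max_le (by linarith) hB0) (h1 _ _ _ _)
    have e3 : φ o b i j + φ b o i j ≤ ∑ i, ∑ j, (φ o b i j + φ b o i j) := by
      have n0 : ∀ i j, 0 ≤ φ o b i j + φ b o i j := fun i j =>
        add_nonneg (h1 _ _ _ _) (h1 _ _ _ _)
      refine (Finset.single_le_sum (f := fun j => φ o b i j + φ b o i j)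
        (fun j _ => n0 i j) (Finset.mem_univ j)).trans ?_
      exact Finset.single_le_sum (f := fun i => ∑ j, (φ o b i j + φ b o i j))
        (fun i _ => Finset.sum_nonneg fun j _ => n0 i j) (Finset.mem_univ i)
    nlinarith [mul_le_mul_of_nonneg_right e3 hB0]
  · intro v hv i
    have key : ∀ b, ∑ j, (max (v b) 0 * φ o b j i + max (-v b) 0 * φ b o j i)
        - ∑ j, (max (v b) 0 * φ o b i j + max (-v b) 0 * φ b o i j)
        = (if i = b then v b else 0) - v b * (if i = o then 1 else 0) := by
      intro b
      have a1 := h3 o b i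
      have a2 := h3 b o i
      have a3 : max (v b) 0 - max (-v b) 0 = v b := by
        rcases le_total (v b) 0 with h | h
        · rw [max_eq_right h, max_eq_left (by linarith)]; ring
        · rw [max_eq_left h, max_eq_right (by linarith)]; ring
      simp only [Finset.sum_add_distrib, ← Finset.mul_sum]
      have : (if i = b then v b else 0) = v b * (if i = b then 1 else 0) := by simp
      rw [this]
      generalize (if i = b then (1:ℝ) else 0) = x at *
      generalize (if i = o then (1:ℝ) else 0) = y at *
      linear_combination max (v b) 0 * a1 + max (-v b) 0 * a2 + (x - y) * a3
    rw [Finset.sum_comm, Finset.sum_comm (f := fun j b => _ * φ o b i j + _), 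
      ← Finset.sum_sub_distrib, Finset.sum_congr rfl fun b _ => key b, Finset.sum_sub_distrib,
      ← Finset.sum_mul, hv]
    simp

lemma cost_bound {m lam l c Cb A : ℝ} (hm0 : 0 ≤ m) (hm1 : m ≤ 1) (hc : 0 < c) (hl : 0 ≤ l)
    (h1 : c ≤ lam) (h2 : lam ≤ Cb) (hA : m * l ^ 2 ≤ A) :
    m * lam * tauStar (l / lam - 1) ≤ A / c + Cb := by
  have hlam : 0 < lam := hc.trans_le h1
  have hx : 0 ≤ l / lam := by positivity
  have ht : tauStar (l / lam - 1) ≤ (l / lam) ^ 2 + 1 := by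
    unfold tauStar
    rw [sub_add_cancel]
    rcases hx.eq_or_lt with h | h
    · rw [← h]; simp
    · have := Real.log_le_sub_one_of_pos h
      nlinarith
  have hA0 : 0 ≤ A := le_trans (by positivity) hA
  calc m * lam * tauStar (l / lam - 1) ≤ m * lam * ((l / lam) ^ 2 + 1) := by gcongr
    _ = m * l ^ 2 / lam + m * lam := by field_simp
    _ ≤ A / c + 1 * Cb := by gcongr
    _ = _ := by ring

lemma SEnd_le (M : MeanFieldModel r) {ε A : ℝ} (hε : 0 < ε) {ν ξ : Fin r → ℝ}
    (μ v : ℝ → Fin r → ℝ) (f : ℝ → Fin r → Fin r → ℝ)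
    (h0 : μ 0 = ν) (hT : μ ε = ξ) (hv : Continuous v)
    (hd : ∀ t i, HasDerivAt (fun t => μ t i) (v t i) t)
    (hs : ∀ t ∈ Icc (0 : ℝ) ε, μ t ∈ stdSimplex ℝ (Fin r))
    (hfc : ∀ i j, Continuous fun t => f t i j)
    (hf0 : ∀ t i j, 0 ≤ f t i j) (hfE : ∀ t i j, (i, j) ∉ M.E → f t i j = 0)
    (hdiv : ∀ t ∈ Icc (0 : ℝ) ε, ∀ i, ∑ j, f t j i - ∑ j, f t i j = v t i)
    (hA : ∀ t ∈ Icc (0 : ℝ) ε, ∀ i j, f t i j ^ 2 ≤ A * μ t i) :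
    SEnd M ε ν ξ ≤ ENNReal.ofReal ((M.E.card * (A / M.c + M.Cb)) * ε) := by
  have hμc : ∀ i, Continuous fun t => μ t i := fun i =>
    continuous_iff_continuousAt.2 fun t => (hd t i).continuousAt
  let g : ℝ → Fin r → Fin r → ℝ := fun t i j => f t i j / |μ t i|
  let L : ℝ → Fin r → Fin r → ℝ := fun t i j =>
    if i = j then -∑ k ∈ Finset.univ.filter (fun k => k ≠ i), g t i k else g t i j
  have hgm : ∀ i j, Measurable fun t => g t i j := fun i j =>
    (hfc i j).measurable.div (hμc i).abs.measurable
  have hg0 : ∀ t i j, 0 ≤ g t i j := fun t i j => div_nonneg (hf0 t i j) (abs_nonneg _)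
  have hLne : ∀ t i j, i ≠ j → L t i j = g t i j := fun t i j h => if_neg h
  have hLd : ∀ t i, L t i i = -∑ k ∈ Finset.univ.filter (fun k => k ≠ i), g t i k :=
    fun t i => if_pos rfl
  have hL : IsRateMatrix M L := by
    refine ⟨?_, ?_, ?_, ?_⟩
    · intro i j
      by_cases h : i = j
      · subst h
        simp only [hLd]
        exact (Finset.measurable_sum _ fun k _ => hgm i k).neg
      · simp only [hLne _ i j h]; exact hgm i j
    · intro t i j h
      rw [hLne _ _ _ h]; exact hg0 _ _ _
    · intro t i j h hE
      rw [hLne _ _ _ h]; simp [g, hfE t i j hE]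
    · intro t i
      rw [hLd]
      congr 1
      refine Finset.sum_congr rfl fun k hk => ?_
      rw [hLne _ _ _ (Finset.mem_filter.1 hk).2.symm]
  have hgf : ∀ t ∈ Icc (0 : ℝ) ε, ∀ i j, g t i j * μ t i = f t i j := by
    intro t ht i j
    have hm := (hs t ht).1 i
    have := hA t ht i j
    rcases hm.eq_or_lt with h | h
    · rw [← h] at this
      have : f t i j = 0 := by nlinarith
      simp [g, this]
    · simp only [g, abs_of_pos h]; field_simp
  have hode : ∀ t ∈ Icc (0 : ℝ) ε, ∀ i, ∑ j, L t j i * μ t j = v t i := by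
    intro t ht i
    rw [← hdiv t ht i, ← Finset.add_sum_erase _ _ (Finset.mem_univ i),
      ← Finset.add_sum_erase _ (fun j => f t j i) (Finset.mem_univ i),
      ← Finset.add_sum_erase _ (fun j => f t i j) (Finset.mem_univ i), hLd]
    have e : Finset.univ.filter (fun k => k ≠ i) = Finset.univ.erase i := by
      ext; simp
    rw [e, neg_mul, Finset.sum_mul, Finset.sum_congr rfl fun k _ => hgf t ht i k]
    have e2 : ∑ k ∈ Finset.univ.erase i, L t k i * μ t k = ∑ k ∈ Finset.univ.erase i, f t k i :=
      Finset.sum_congr rfl fun k hk => by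
        rw [hLne t k i (Finset.ne_of_mem_erase hk), hgf t ht k i]
    rw [e2]
    ring
  have hvi : ∀ i, Continuous fun t => v t i := fun i => (continuous_apply i).comp hv
  have hsol : SolvesODE L μ ε := by
    constructor
    · intro i
      refine ((hvi i).integrableOn_Icc (a := 0) (b := ε)).congr_fun
        (fun t ht => (hode t ht i).symm) measurableSet_Icc
    · intro t ht i
      rw [setIntegral_congr_fun (g := fun s => v s i) measurableSet_Ioc
        (fun s hs' => hode s ⟨hs'.1.le, hs'.2.trans ht.2⟩ i),
        ← intervalIntegral.integral_of_le ht.1,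
        intervalIntegral.integral_eq_sub_of_hasDerivAt (fun s _ => hd s i)
          ((hvi i).intervalIntegrable _ _)]
      ring
  refine (iInf₂_le μ ⟨h0, hT⟩).trans ?_
  refine (iInf₂_le L ⟨hL, hsol, h0, hs⟩).trans ?_
  unfold runningCost
  calc _ ≤ ∫⁻ t in Ioc (0 : ℝ) ε, ENNReal.ofReal (M.E.card * (A / M.c + M.Cb)) := by
        refine setLIntegral_mono measurable_const fun t ht => ENNReal.ofReal_le_ofReal ?_
        have ht' : t ∈ Icc (0:ℝ) ε := ⟨ht.1.le, ht.2⟩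
        rw [← nsmul_eq_mul]
        refine Finset.sum_le_card_nsmul _ _ _ fun p hp => ?_
        have hne : p.1 ≠ p.2 := fun h => M.no_diag p.1 (by
          have : (p.1, p.1) = p := Prod.ext rfl h
          rwa [this])
        rw [hLne _ _ _ hne]
        have hm := (hs t ht').1 p.1
        refine cost_bound hm ?_ M.c_pos (hg0 _ _ _) (M.lam_lower p hp _ (hs t ht'))
          (M.lam_upper p hp _ (hs t ht')) ?_
        · rw [← (hs t ht').2]
          exact Finset.single_le_sum (f := μ t) (fun j _ => (hs t ht').1 j) (Finset.mem_univ p.1)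
        · have h1 := hA t ht' p.1 p.2
          rcases hm.eq_or_lt with h | h
          · -- A ≥ 0 is needed here
            have hex : ∃ j, 0 < μ t j := by
              by_contra hcon
              push Not at hcon
              have := Finset.sum_nonpos fun j (_ : j ∈ Finset.univ) => hcon j
              rw [(hs t ht').2] at this
              linarith
            obtain ⟨j, hj⟩ := hex
            have h2 := hA t ht' j j
            have : 0 ≤ A := by
              by_contra hA'
              nlinarith [sq_nonneg (f t j j), mul_neg_of_neg_of_pos (not_le.1 hA') hj]
            rw [← h]; simpa using this
          · have e : μ t p.1 * g t p.1 p.2 ^ 2 = f t p.1 p.2 ^ 2 / μ t p.1 := by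
              simp only [g, abs_of_pos h]; field_simp
            rw [e, div_le_iff₀ h]; exact h1
    _ = _ := by
        rw [setLIntegral_const, Real.volume_Ioc, sub_zero, ENNReal.ofReal_mul' hε.le]

end Helpers

/-- there is a constant `C₂ < ∞` such that for every `ε > 0` there
is `δ ∈ (0, ε)` with: `ρ₀(ν,ξ) < δ` implies `S_ε(ξ|ν) ≤ C₂ ε`. -/
theorem stmt1 (r : ℕ) (hr : 0 < r) (M : MeanFieldModel r) :
    ∃ C₂ : ℝ, ∀ ε : ℝ, 0 < ε → ∃ δ : ℝ, 0 < δ ∧ δ < ε ∧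
      ∀ ν ∈ stdSimplex ℝ (Fin r), ∀ ξ ∈ stdSimplex ℝ (Fin r),
        dist ν ξ < δ → SEnd M ε ν ξ ≤ ENNReal.ofReal (C₂ * ε) := by
  obtain ⟨K, F, hK, hFc, hF0, hFE, hFB, hFdiv⟩ := exists_flow hr M
  have hr' : (0:ℝ) < r := by exact_mod_cast hr
  refine ⟨M.E.card * ((9 * K ^ 2 * r) / M.c + M.Cb), fun ε hε => ?_⟩
  obtain ⟨k, hk⟩ : ∃ k, k = 1 / (1 + ε) ^ 2 := ⟨_, rfl⟩
  have hk0 : 0 < k := by rw [hk]; positivity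
  have hkeq : k * (1 + ε) ^ 2 = 1 := by rw [hk]; field_simp
  have hkε : k * ε ≤ 1 := by nlinarith [mul_pos hk0 hε, mul_pos (mul_pos hk0 hε) hε]
  have hkε2 : k * ε ^ 2 ≤ 1 := by nlinarith [mul_pos hk0 hε]
  refine ⟨k * ε ^ 3 / 6, by positivity, ?_, ?_⟩
  · have : k * ε ^ 3 = (k * ε ^ 2) * ε := by ring
    nlinarith
  intro ν hν ξ hξ hdist
  let q : ℝ → ℝ := fun t => t * (ε - t)
  let s : ℝ → ℝ := fun t => (k * (t * (ε - t))) ^ 2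
  let s' : ℝ → ℝ := fun t => 2 * k ^ 2 * (t * (ε - t)) * (ε - 2 * t)
  let θ : ℝ → ℝ := fun t => t ^ 2 * (3 * ε - 2 * t) / ε ^ 3
  let θ' : ℝ → ℝ := fun t => 6 * (t * (ε - t)) / ε ^ 3
  let ln : ℝ → Fin r → ℝ := fun t i => (1 - θ t) * ν i + θ t * ξ i
  let μ : ℝ → Fin r → ℝ := fun t i => (1 - s t) * ln t i + s t * (1 / r)
  let v : ℝ → Fin r → ℝ := fun t i =>
    s' t * (1 / r - ln t i) + (1 - s t) * (θ' t * (ξ i - ν i))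
  have hsd : ∀ t, HasDerivAt s (s' t) t := by
    intro t
    have h1 : HasDerivAt (fun t : ℝ => k * (t * (ε - t))) (k * (1 * (ε - t) + t * (-1))) t :=
      ((hasDerivAt_id t).mul ((hasDerivAt_id t).const_sub ε)).const_mul k
    refine (h1.pow 2).congr_deriv ?_
    simp only [s']; push_cast; ring
  have hθd : ∀ t, HasDerivAt θ (θ' t) t := by
    intro t
    have h1 : HasDerivAt (fun t : ℝ => 3 * ε - 2 * t) (-(2 * 1)) t :=
      ((hasDerivAt_id t).const_mul 2).const_sub (3 * ε)
    have h2 := (((hasDerivAt_id t).pow 2).mul h1).div_const (ε ^ 3)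
    refine h2.congr_deriv ?_
    simp only [θ', id, Pi.pow_apply]; push_cast; ring
  have hlnd : ∀ t i, HasDerivAt (fun t => ln t i) (θ' t * (ξ i - ν i)) t := by
    intro t i
    refine ((((hθd t).const_sub 1).mul_const (ν i)).add ((hθd t).mul_const (ξ i))).congr_deriv ?_
    ring
  have hμd : ∀ t i, HasDerivAt (fun t => μ t i) (v t i) t := by
    intro t i
    refine ((((hsd t).const_sub 1).mul (hlnd t i)).add
      ((hsd t).mul_const (1 / (r:ℝ)))).congr_deriv ?_
    simp only [v]; ring
  have hsumpi : ∑ _i : Fin r, (1 / (r:ℝ)) = 1 := by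
    simp; field_simp
  have hsumln : ∀ t, ∑ i, ln t i = 1 := by
    intro t
    simp only [ln, Finset.sum_add_distrib, ← Finset.mul_sum, hν.2, hξ.2]; ring
  have hvsum : ∀ t, ∑ i, v t i = 0 := by
    intro t
    simp only [v, Finset.sum_add_distrib, ← Finset.mul_sum, Finset.sum_sub_distrib, hsumpi,
      hsumln, hν.2, hξ.2]; ring
  have hq : ∀ t ∈ Icc (0:ℝ) ε, 0 ≤ t * (ε - t) := fun t ht =>
    mul_nonneg ht.1 (sub_nonneg.2 ht.2)
  have hs1 : ∀ t ∈ Icc (0:ℝ) ε, s t ≤ 1 := by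
    intro t ht
    have h1 : k * (t * (ε - t)) ≤ 1 := by
      have : t * (ε - t) ≤ ε ^ 2 := by nlinarith [ht.1, ht.2]
      nlinarith
    exact pow_le_one₀ (mul_nonneg hk0.le (hq t ht)) h1
  have hs0 : ∀ t, 0 ≤ s t := fun t => sq_nonneg _
  have hθ0 : ∀ t ∈ Icc (0:ℝ) ε, 0 ≤ θ t := by
    intro t ht
    have : 0 ≤ 3 * ε - 2 * t := by linarith [ht.2]
    simp only [θ]; positivity
  have hθ1 : ∀ t ∈ Icc (0:ℝ) ε, θ t ≤ 1 := by
    intro t ht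
    simp only [θ]
    rw [div_le_one (by positivity)]
    have : 0 ≤ (ε - t) ^ 2 * (ε + 2 * t) := mul_nonneg (sq_nonneg _) (by linarith [ht.1])
    nlinarith
  have hln0 : ∀ t ∈ Icc (0:ℝ) ε, ∀ i, 0 ≤ ln t i := fun t ht i =>
    add_nonneg (mul_nonneg (sub_nonneg.2 (hθ1 t ht)) (hν.1 i)) (mul_nonneg (hθ0 t ht) (hξ.1 i))
  have hln1 : ∀ t ∈ Icc (0:ℝ) ε, ∀ i, ln t i ≤ 1 := by
    intro t ht i
    rw [← hsumln t]
    exact Finset.single_le_sum (f := ln t) (fun j _ => hln0 t ht j) (Finset.mem_univ i)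
  have hμs : ∀ t ∈ Icc (0:ℝ) ε, ∀ i, s t * (1 / r) ≤ μ t i := fun t ht i =>
    le_add_of_nonneg_left (mul_nonneg (sub_nonneg.2 (hs1 t ht)) (hln0 t ht i))
  have hvB : ∀ t ∈ Icc (0:ℝ) ε, ∀ b, |v t b| ≤ 3 * (k * (t * (ε - t))) := by
    intro t ht b
    have hq' := hq t ht
    have hpi0 : (0:ℝ) ≤ 1 / r := by positivity
    have hpi1 : (1:ℝ) / r ≤ 1 := by
      rw [div_le_one hr']; exact_mod_cast hr
    have b1 : |1 / (r:ℝ) - ln t b| ≤ 1 :=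
      abs_le.2 ⟨by linarith [hln1 t ht b], by linarith [hln0 t ht b]⟩
    have b2 : |s' t| ≤ 2 * (k * (t * (ε - t))) := by
      have e : |ε - 2 * t| ≤ ε := abs_le.2 ⟨by linarith [ht.2], by linarith [ht.1]⟩
      have : |s' t| = 2 * (k * (t * (ε - t))) * (k * |ε - 2 * t|) := by
        simp only [s']
        rw [abs_mul, abs_of_nonneg (by positivity)]; ring
      rw [this]
      have h' : k * |ε - 2 * t| ≤ 1 := (mul_le_mul_of_nonneg_left e hk0.le).trans hkε
      exact mul_le_of_le_one_right (by positivity) h'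
    have b3 : |ξ b - ν b| ≤ k * ε ^ 3 / 6 := by
      have := (dist_le_pi_dist ν ξ b).trans hdist.le
      rwa [dist_comm, Real.dist_eq] at this
    have b4 : |1 - s t| ≤ 1 := abs_le.2 ⟨by linarith [hs1 t ht], by linarith [hs0 t]⟩
    have b5 : |θ' t * (ξ b - ν b)| ≤ k * (t * (ε - t)) := by
      have h0 : 0 ≤ θ' t := by simp only [θ']; positivity
      rw [abs_mul, abs_of_nonneg h0]
      refine (mul_le_mul_of_nonneg_left b3 h0).trans (le_of_eq ?_)
      simp only [θ']; field_simp
    calc |v t b| ≤ |s' t| * |1 / (r:ℝ) - ln t b| + |1 - s t| * |θ' t * (ξ b - ν b)| := by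
          rw [← abs_mul, ← abs_mul]; exact abs_add_le _ _
      _ ≤ (2 * (k * (t * (ε - t)))) * 1 + 1 * (k * (t * (ε - t))) := by gcongr
      _ = _ := by ring
  have hvc : Continuous v := by
    refine continuous_pi fun i => ?_
    simp only [v, s', s, θ', ln, θ]
    fun_prop
  refine SEnd_le M hε μ v (fun t => F (v t)) ?_ ?_ hvc hμd ?_ ?_ ?_ ?_ ?_ ?_
  · funext i; simp [μ, s, ln, θ]
  · funext i
    have : θ ε = 1 := by simp only [θ]; field_simp; ring
    simp [μ, s, ln, this]
  · intro t ht
    refine ⟨fun i => (mul_nonneg (hs0 t) (by positivity)).trans (hμs t ht i), ?_⟩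
    simp only [μ, Finset.sum_add_distrib, ← Finset.mul_sum, hsumpi, hsumln]; ring
  · exact fun i j => (hFc i j).comp hvc
  · exact fun t => hF0 _
  · exact fun t => hFE _
  · exact fun t _ => hFdiv _ (hvsum t)
  · intro t ht i j
    have h1 := hFB (v t) _ (hvB t ht) i j
    calc F (v t) i j ^ 2 ≤ (K * (3 * (k * (t * (ε - t))))) ^ 2 :=
          pow_le_pow_left₀ (hF0 _ _ _) h1 2
      _ = 9 * K ^ 2 * r * (s t * (1 / r)) := by simp only [s]; field_simp; ring
      _ ≤ _ := mul_le_mul_of_nonneg_left (hμs t ht i) (by positivity)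
end

section
/- Under assumptions (A1)–(A3), for each fixed T > 0 the mapping (ν, ξ) ↦ S_T(ξ|ν) is uniformly continuous on M_1(Z) × M_1(Z). -/
open MeasureTheory Set ENNReal Filter

lemma flux_path {r : ℕ} (M : MeanFieldModel r) (k l : Fin r) :
    ∃ P : Fin r → Fin r → ℝ, (∀ i j, 0 ≤ P i j) ∧ (∀ i j, (i, j) ∉ M.E → P i j = 0) ∧
      ∀ i, ∑ j, P j i - ∑ j, P i j = (if i = l then 1 else 0) - (if i = k then 1 else 0) := by
  induction M.irreducible k l with
  | refl => exact ⟨fun _ _ => 0, by simp, by simp, by simp⟩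
  | @tail b d _ hbd ih =>
    obtain ⟨P, h0, h1, h2⟩ := ih
    refine ⟨fun i j => P i j + (if i = b then 1 else 0) * (if j = d then 1 else 0), ?_, ?_, ?_⟩
    · intro i j
      have := h0 i j
      positivity
    · intro i j hij
      have h := h1 i j hij
      by_cases hi : i = b
      · by_cases hj : j = d
        · subst hi; subst hj; exact absurd hbd hij
        · simp [h, hj]
      · simp [h, hi]
    · intro i
      have := h2 i
      simp only [Finset.sum_add_distrib, ← Finset.sum_mul, ← Finset.mul_sum]
      simp only [Finset.sum_ite_eq', Finset.mem_univ, if_true]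
      linarith

lemma flux {r : ℕ} (hr : 0 < r) (M : MeanFieldModel r) :
    ∃ C : ℝ, 0 ≤ C ∧ ∃ W : (Fin r → ℝ) → Fin r → Fin r → ℝ,
      (∀ i j, Continuous fun v => W v i j) ∧ (∀ v i j, 0 ≤ W v i j) ∧
      (∀ v i j, (i, j) ∉ M.E → W v i j = 0) ∧
      (∀ v B, (∀ i, |v i| ≤ B) → ∀ i j, W v i j ≤ C * B) ∧
      (∀ v, ∑ i, v i = 0 → ∀ i, ∑ j, W v j i - ∑ j, W v i j = v i) := by
  choose P h0 h1 h2 using flux_path M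
  let z : Fin r := ⟨0, hr⟩
  have hs : ∀ i j, 0 ≤ ∑ l, (P z l i j + P l z i j) := fun i j =>
    Finset.sum_nonneg fun l _ => add_nonneg (h0 _ _ _ _) (h0 _ _ _ _)
  refine ⟨∑ i, ∑ j, ∑ l, (P z l i j + P l z i j), ?_,
    fun v i j => ∑ l, (max (v l) 0 * P z l i j + max (-v l) 0 * P l z i j), ?_, ?_, ?_, ?_, ?_⟩
  · exact Finset.sum_nonneg fun i _ => Finset.sum_nonneg fun j _ => hs i j
  · intro i j; fun_prop
  · intro v i j
    exact Finset.sum_nonneg fun l _ => add_nonneg (mul_nonneg (le_max_right _ _) (h0 _ _ _ _))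
      (mul_nonneg (le_max_right _ _) (h0 _ _ _ _))
  · intro v i j hij
    exact Finset.sum_eq_zero fun l _ => by simp [h1 _ _ i j hij]
  · intro v B hB i j
    have hB0 : 0 ≤ B := (abs_nonneg _).trans (hB z)
    calc ∑ l, (max (v l) 0 * P z l i j + max (-v l) 0 * P l z i j)
        ≤ ∑ l, (P z l i j + P l z i j) * B := by
          refine Finset.sum_le_sum fun l _ => ?_
          have a1 : max (v l) 0 ≤ B := max_le ((le_abs_self _).trans (hB l)) hB0
          have a2 : max (-v l) 0 ≤ B := max_le ((neg_le_abs _).trans (hB l)) hB0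
          have := mul_le_mul_of_nonneg_right a1 (h0 z l i j)
          have := mul_le_mul_of_nonneg_right a2 (h0 l z i j)
          linarith
      _ = (∑ l, (P z l i j + P l z i j)) * B := by rw [Finset.sum_mul]
      _ ≤ _ := by
          refine mul_le_mul_of_nonneg_right ?_ hB0
          refine le_trans ?_ (Finset.single_le_sum (f := fun i => ∑ j, ∑ l, (P z l i j + P l z i j))
            (fun i _ => Finset.sum_nonneg fun j _ => hs i j) (Finset.mem_univ i))
          exact Finset.single_le_sum (f := fun j => ∑ l, (P z l i j + P l z i j))
            (fun j _ => hs i j) (Finset.mem_univ j)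
  · intro v hv i
    have : ∀ l, ∑ j, (max (v l) 0 * P z l j i + max (-v l) 0 * P l z j i)
        - ∑ j, (max (v l) 0 * P z l i j + max (-v l) 0 * P l z i j)
        = v l * (if i = l then 1 else 0) - v l * (if i = z then 1 else 0) := by
      intro l
      simp only [Finset.sum_add_distrib, ← Finset.mul_sum]
      have e1 := h2 z l i
      have e2 := h2 l z i
      have e3 : max (v l) 0 - max (-v l) 0 = v l := by
        rcases le_total (v l) 0 with h | h
        · rw [max_eq_right h, max_eq_left (by linarith)]; ring
        · rw [max_eq_left h, max_eq_right (by linarith)]; ring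
      linear_combination (max (v l) 0) * e1 + (max (-v l) 0) * e2 +
        ((if i = l then 1 else 0) - (if i = z then 1 else 0)) * e3
    have e : (∑ j, ∑ l, (max (v l) 0 * P z l j i + max (-v l) 0 * P l z j i))
        - ∑ j, ∑ l, (max (v l) 0 * P z l i j + max (-v l) 0 * P l z i j)
        = ∑ l, (∑ j, (max (v l) 0 * P z l j i + max (-v l) 0 * P l z j i)
        - ∑ j, (max (v l) 0 * P z l i j + max (-v l) 0 * P l z i j)) := by
      rw [Finset.sum_sub_distrib]
      congr 1 <;> exact Finset.sum_comm
    refine e.trans ?_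
    rw [Finset.sum_congr rfl fun l _ => this l, Finset.sum_sub_distrib, ← Finset.sum_mul, hv]
    simp

lemma tau_nonneg {x : ℝ} (hx : 0 ≤ x) : 0 ≤ tauStar (x - 1) := by
  unfold tauStar
  have := Real.self_sub_one_le_mul_log hx
  simp only [sub_add_cancel]; linarith

lemma tau_le_sq {x : ℝ} (hx : 0 ≤ x) : tauStar (x - 1) ≤ (x - 1) ^ 2 := by
  unfold tauStar
  simp only [sub_add_cancel]
  rcases hx.eq_or_lt with h | h
  · subst h; simp
  · nlinarith [Real.log_le_sub_one_of_pos h]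

lemma le_tau {x : ℝ} (hx : 0 ≤ x) : x ≤ tauStar (x - 1) + 2 := by
  unfold tauStar
  simp only [sub_add_cancel]
  rcases hx.eq_or_lt with h | h
  · subst h; norm_num
  · have h1 := Real.add_one_le_exp (1 - Real.log x)
    rw [Real.exp_sub, Real.exp_log h, le_div_iff₀ h] at h1
    have := Real.exp_one_lt_d9
    nlinarith

lemma tau_scale {x a : ℝ} (hx : 0 ≤ x) (ha : 1 ≤ a) :
    tauStar (a * x - 1) ≤ a * ((1 + Real.log a) * tauStar (x - 1) + Real.log a * 2) := by
  have hl := Real.log_nonneg ha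
  have h1 : tauStar (a * x - 1) = a * tauStar (x - 1) + a * x * Real.log a + 1 - a := by
    unfold tauStar
    simp only [sub_add_cancel]
    rcases hx.eq_or_lt with h | h
    · subst h; simp
    · rw [Real.log_mul (by linarith) h.ne']; ring
  have h2 := le_tau hx
  have h3 : a * x * Real.log a ≤ a * (tauStar (x - 1) + 2) * Real.log a := by gcongr
  nlinarith

def Reach {r : ℕ} (M : MeanFieldModel r) (T : ℝ) (ν ξ : Fin r → ℝ) (c : ℝ≥0∞) : Prop :=
  ∃ (μ : ℝ → Fin r → ℝ) (L : ℝ → Fin r → Fin r → ℝ),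
    IsRateMatrix M L ∧ SolvesODE L μ T ∧ μ 0 = ν ∧ μ T = ξ ∧
    (∀ t ∈ Icc (0 : ℝ) T, μ t ∈ stdSimplex ℝ (Fin r)) ∧ runningCost M μ L T ≤ c

lemma Reach.le {r : ℕ} {M : MeanFieldModel r} {T : ℝ} {ν ξ : Fin r → ℝ} {c : ℝ≥0∞}
    (h : Reach M T ν ξ c) : SEnd M T ν ξ ≤ c := by
  obtain ⟨μ, L, h1, h2, h3, h4, h5, h6⟩ := h
  unfold SEnd SPath
  exact (iInf₂_le μ ⟨h3, h4⟩).trans ((iInf₂_le L ⟨h1, h2, h3, h5⟩).trans h6)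

lemma exists_reach {r : ℕ} {M : MeanFieldModel r} {T : ℝ} {ν ξ : Fin r → ℝ} {c : ℝ≥0∞}
    (h : SEnd M T ν ξ < c) : Reach M T ν ξ c := by
  unfold SEnd SPath at h
  simp only [iInf_lt_iff] at h
  obtain ⟨μ, ⟨h3, h4⟩, L, ⟨h1, h2, h3, h5⟩, h6⟩ := h
  exact ⟨μ, L, h1, h2, h3, h4, h5, h6.le⟩

lemma lintegral_Ioc_shift (f : ℝ → ℝ≥0∞) (a b d : ℝ) :
    ∫⁻ s in Ioc a b, f (s - d) = ∫⁻ s in Ioc (a - d) (b - d), f s := by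
  have h := (measurePreserving_sub_right (volume : Measure ℝ) d).setLIntegral_comp_preimage_emb
    (measurableEmbedding_subRight d) f (Ioc (a - d) (b - d))
  rw [← h]
  simp

lemma lintegral_Ioc_scale (f : ℝ → ℝ≥0∞) (b : ℝ) {a : ℝ} (ha : 0 < a) :
    ∫⁻ s in Ioc 0 b, ENNReal.ofReal a * f (a * s) = ∫⁻ s in Ioc 0 (a * b), f s := by
  have h1 := Real.smul_map_volume_mul_left ha.ne'
  have hm := measurableEmbedding_mulLeft₀ ha.ne'
  rw [lintegral_const_mul' _ _ ENNReal.ofReal_ne_top]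
  conv_rhs => rw [← h1]
  rw [Measure.restrict_smul, lintegral_smul_measure, abs_of_pos ha, hm.restrict_map, hm.lintegral_map]
  have : (fun x => a * x) ⁻¹' Ioc 0 (a * b) = Ioc 0 b := by
    ext x; simp only [mem_preimage, mem_Ioc, mul_le_mul_iff_right₀ ha, mul_pos_iff_of_pos_left ha]
  rw [this]; rfl

lemma Reach.concat {r : ℕ} {M : MeanFieldModel r} {T₁ T₂ : ℝ} (hT₁ : 0 ≤ T₁) (hT₂ : 0 < T₂)
    {ν η ξ : Fin r → ℝ} {c₁ c₂ : ℝ≥0∞}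
    (h₁ : Reach M T₁ ν η c₁) (h₂ : Reach M T₂ η ξ c₂) : Reach M (T₁ + T₂) ν ξ (c₁ + c₂) := by
  obtain ⟨μ₁, L₁, ⟨m1, n1, o1, d1⟩, ⟨i1, s1⟩, z1, e1, x1, k1⟩ := h₁
  obtain ⟨μ₂, L₂, ⟨m2, n2, o2, d2⟩, ⟨i2, s2⟩, z2, e2, x2, k2⟩ := h₂
  set μ : ℝ → Fin r → ℝ := fun s => if s ≤ T₁ then μ₁ s else μ₂ (s - T₁) with hμ
  set L : ℝ → Fin r → Fin r → ℝ := fun s => if s ≤ T₁ then L₁ s else L₂ (s - T₁) with hL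
  have hμ1 : ∀ s, s ≤ T₁ → μ s = μ₁ s := fun s hs => by simp [hμ, hs]
  have hL1 : ∀ s, s ≤ T₁ → L s = L₁ s := fun s hs => by simp [hL, hs]
  have hμ2 : ∀ s, T₁ < s → μ s = μ₂ (s - T₁) := fun s hs => by simp [hμ, hs.not_ge]
  have hL2 : ∀ s, T₁ < s → L s = L₂ (s - T₁) := fun s hs => by simp [hL, hs.not_ge]
  have II1 : ∀ i, IntegrableOn (fun t => ∑ j, L t j i * μ t j) (Ioc 0 T₁) := by
    intro i
    refine ((i1 i).mono_set Ioc_subset_Icc_self).congr_fun ?_ measurableSet_Ioc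
    intro s hs; simp only [hμ1 s hs.2, hL1 s hs.2]
  have II2 : ∀ i, IntegrableOn (fun t => ∑ j, L t j i * μ t j) (Ioc T₁ (T₁ + T₂)) := by
    intro i
    have h := (i2 i).mono_set Ioc_subset_Icc_self
    rw [← intervalIntegrable_iff_integrableOn_Ioc_of_le hT₂.le] at h
    have h := h.comp_sub_right T₁
    rw [intervalIntegrable_iff_integrableOn_Ioc_of_le (by linarith), zero_add, add_comm] at h
    refine h.congr_fun ?_ measurableSet_Ioc
    intro s hs; simp only [hμ2 s hs.1, hL2 s hs.1]
  have hU : ∀ t, T₁ ≤ t → Ioc 0 t = Ioc 0 T₁ ∪ Ioc T₁ t := fun t ht =>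
    (Ioc_union_Ioc_eq_Ioc hT₁ ht).symm
  have F1 : ∀ t ∈ Icc 0 T₁, ∀ i, ∫ s in Ioc 0 t, ∑ j, L s j i * μ s j
      = ∫ s in Ioc 0 t, ∑ j, L₁ s j i * μ₁ s j := by
    intro t ht i
    refine setIntegral_congr_fun measurableSet_Ioc ?_
    intro s hs; simp only [hμ1 s (hs.2.trans ht.2), hL1 s (hs.2.trans ht.2)]
  refine ⟨μ, L, ⟨?_, ?_, ?_, ?_⟩, ⟨?_, ?_⟩, ?_, ?_, ?_, ?_⟩
  · intro i j
    have : (fun t => L t i j) = fun t => if t ≤ T₁ then L₁ t i j else L₂ (t - T₁) i j := by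
      ext t; simp only [hL]; split_ifs <;> rfl
    rw [this]
    exact Measurable.ite measurableSet_Iic (m1 i j) ((m2 i j).comp (measurable_id.sub_const T₁))
  · intro t i j hij
    simp only [hL]; split_ifs
    · exact n1 _ _ _ hij
    · exact n2 _ _ _ hij
  · intro t i j hij hE
    simp only [hL]; split_ifs
    · exact o1 _ _ _ hij hE
    · exact o2 _ _ _ hij hE
  · intro t i
    simp only [hL]; split_ifs
    · exact d1 _ _
    · exact d2 _ _
  · intro i
    rw [integrableOn_Icc_iff_integrableOn_Ioc, hU _ (by linarith)]
    exact (II1 i).union (II2 i)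
  · intro t ht i
    rcases le_or_gt t T₁ with h | h
    · rw [F1 t ⟨ht.1, h⟩, hμ1 t h, hμ1 0 hT₁]
      exact s1 t ⟨ht.1, h⟩ i
    · have ht' : t - T₁ ∈ Icc 0 T₂ := ⟨by linarith, by linarith [ht.2]⟩
      rw [hU t h.le, setIntegral_union (by
          rw [Set.disjoint_left]; intro s hs hs'; exact absurd hs.2 hs'.1.not_ge) measurableSet_Ioc
          (II1 i) ((II2 i).mono_set (Ioc_subset_Ioc_right ht.2)), F1 T₁ ⟨hT₁, le_rfl⟩ i,
          hμ1 0 hT₁, ← add_assoc, ← s1 T₁ ⟨hT₁, le_rfl⟩ i, hμ2 t h, s2 _ ht' i, e1, z2]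
      congr 1
      have : ∫ s in Ioc T₁ t, ∑ j, L s j i * μ s j
          = ∫ s in Ioc T₁ t, (fun s => ∑ j, L₂ s j i * μ₂ s j) (s - T₁) := by
        refine setIntegral_congr_fun measurableSet_Ioc ?_
        intro s hs; simp only [hμ2 s hs.1, hL2 s hs.1]
      rw [this, ← intervalIntegral.integral_of_le h.le, intervalIntegral.integral_comp_sub_right
        (fun s => ∑ j, L₂ s j i * μ₂ s j), sub_self, intervalIntegral.integral_of_le ht'.1]
  · rw [hμ1 0 hT₁, z1]
  · rw [hμ2 _ (by linarith), add_sub_cancel_left, e2]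
  · intro t ht
    rcases le_or_gt t T₁ with h | h
    · rw [hμ1 t h]; exact x1 t ⟨ht.1, h⟩
    · rw [hμ2 t h]; exact x2 _ ⟨by linarith, by linarith [ht.2]⟩
  · unfold runningCost at *
    rw [hU _ (by linarith : T₁ ≤ T₁ + T₂)]
    refine (lintegral_union_le _ _ _).trans (add_le_add (le_trans (le_of_eq ?_) k1)
      (le_trans (le_of_eq ?_) k2))
    · refine setLIntegral_congr_fun measurableSet_Ioc ?_
      intro s hs; simp only [hμ1 s hs.2, hL1 s hs.2]
    · have h := lintegral_Ioc_shift (fun t => ENNReal.ofReal (∑ p ∈ M.E,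
        μ₂ t p.1 * M.lam p.1 p.2 (μ₂ t) * tauStar (L₂ t p.1 p.2 / M.lam p.1 p.2 (μ₂ t) - 1)))
        T₁ (T₁ + T₂) T₁
      rw [sub_self, add_sub_cancel_left] at h
      rw [← h]
      refine setLIntegral_congr_fun measurableSet_Ioc ?_
      intro s hs; simp only [hμ2 s hs.1, hL2 s hs.1]

lemma Reach.scale {r : ℕ} {M : MeanFieldModel r} {T a : ℝ} (hT : 0 < T) (ha : 1 ≤ a)
    {ν ξ : Fin r → ℝ} {c : ℝ≥0∞} (h : Reach M (a * T) ν ξ c) :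
    Reach M T ν ξ (ENNReal.ofReal (1 + Real.log a) * c +
      ENNReal.ofReal (Real.log a * 2 * (M.E.card * |M.Cb|)) * ENNReal.ofReal (a * T)) := by
  obtain ⟨μ, L, ⟨m1, n1, o1, d1⟩, ⟨i1, s1⟩, z1, e1, x1, k1⟩ := h
  have ha0 : 0 < a := by linarith
  have hl := Real.log_nonneg ha
  have hmem : ∀ t ∈ Icc 0 T, a * t ∈ Icc 0 (a * T) := fun t ht =>
    ⟨mul_nonneg ha0.le ht.1, mul_le_mul_of_nonneg_left ht.2 ha0.le⟩
  have hsum : ∀ i t, ∑ j, a * L (a * t) j i * μ (a * t) j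
      = a * (fun t => ∑ j, L t j i * μ t j) (a * t) := by
    intro i t; rw [Finset.mul_sum]; exact Finset.sum_congr rfl fun j _ => by ring
  refine ⟨fun s => μ (a * s), fun s i j => a * L (a * s) i j, ⟨?_, ?_, ?_, ?_⟩, ⟨?_, ?_⟩,
    by simpa using z1, e1, fun t ht => x1 _ (hmem t ht), ?_⟩
  · intro i j
    exact ((m1 i j).comp (measurable_const_mul a)).const_mul a
  · intro t i j hij
    exact mul_nonneg ha0.le (n1 _ _ _ hij)
  · intro t i j hij hE
    simp [o1 _ _ _ hij hE]
  · intro t i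
    simp only [d1 (a * t) i, Finset.mul_sum, mul_neg]
  · intro i
    simp only [hsum]
    refine Integrable.const_mul ?_ a
    have h := (i1 i).mono_set Ioc_subset_Icc_self
    rw [← intervalIntegrable_iff_integrableOn_Ioc_of_le (mul_nonneg ha0.le hT.le)] at h
    have h := h.comp_mul_left (c := a)
    rw [intervalIntegrable_iff_integrableOn_Ioc_of_le (by rw [mul_div_cancel_left₀ _ ha0.ne', zero_div]; exact hT.le), zero_div,
      mul_div_cancel_left₀ _ ha0.ne', ← integrableOn_Icc_iff_integrableOn_Ioc] at h
    exact h
  · intro t ht i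
    simp only [hsum]
    rw [integral_const_mul, ← intervalIntegral.integral_of_le ht.1,
      intervalIntegral.integral_comp_mul_left (fun t => ∑ j, L t j i * μ t j) ha0.ne', smul_eq_mul, mul_inv_cancel_left₀ ha0.ne',
      mul_zero, intervalIntegral.integral_of_le (hmem t ht).1]
    exact s1 _ (hmem t ht) i
  · unfold runningCost at *
    set f : ℝ → ℝ := fun t => ∑ p ∈ M.E,
        μ t p.1 * M.lam p.1 p.2 (μ t) * tauStar (L t p.1 p.2 / M.lam p.1 p.2 (μ t) - 1) with hf
    set K : ℝ := Real.log a * 2 * (M.E.card * |M.Cb|) with hK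
    have hK0 : 0 ≤ K := by positivity
    have key : ∀ t ∈ Ioc 0 T, ENNReal.ofReal (∑ p ∈ M.E, μ (a * t) p.1 * M.lam p.1 p.2 (μ (a * t))
        * tauStar (a * L (a * t) p.1 p.2 / M.lam p.1 p.2 (μ (a * t)) - 1))
        ≤ ENNReal.ofReal a * (fun t => ENNReal.ofReal (1 + Real.log a) * ENNReal.ofReal (f t)
          + ENNReal.ofReal K) (a * t) := by
      intro t ht
      have hx := x1 _ (hmem t ⟨ht.1.le, ht.2⟩)
      generalize a * t = s at *
      have hf0 : 0 ≤ f s := by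
        refine Finset.sum_nonneg fun p hp => ?_
        have hlam := M.lam_lower p hp _ hx
        have hc := M.c_pos
        have hne : p.1 ≠ p.2 := fun h => M.no_diag p.1 (by
          have : (p.1, p.1) = p := Prod.ext rfl h
          rwa [this])
        exact mul_nonneg (mul_nonneg (hx.1 _) (by linarith))
          (tau_nonneg (div_nonneg (n1 _ _ _ hne) (by linarith)))
      beta_reduce
      rw [← ENNReal.ofReal_mul (by linarith), ← ENNReal.ofReal_add (by positivity) hK0,
        ← ENNReal.ofReal_mul ha0.le]
      refine ENNReal.ofReal_le_ofReal ?_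
      have : a * ((1 + Real.log a) * f s + K) = ∑ p ∈ M.E,
          a * ((1 + Real.log a) * (μ s p.1 * M.lam p.1 p.2 (μ s) *
            tauStar (L s p.1 p.2 / M.lam p.1 p.2 (μ s) - 1)) + Real.log a * 2 * |M.Cb|) := by
        rw [← Finset.mul_sum, Finset.sum_add_distrib, ← Finset.mul_sum, Finset.sum_const,
          nsmul_eq_mul]
        simp only [hf, hK]; ring
      rw [this]
      refine Finset.sum_le_sum fun p hp => ?_
      have hlam := M.lam_lower p hp _ hx
      have hup := M.lam_upper p hp _ hx
      have hc := M.c_pos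
      have hne : p.1 ≠ p.2 := fun h => M.no_diag p.1 (by
        have : (p.1, p.1) = p := Prod.ext rfl h
        rwa [this])
      have hle1 : μ s p.1 ≤ 1 := by
        rw [← hx.2]; exact Finset.single_le_sum (fun i _ => hx.1 i) (Finset.mem_univ _)
      have hx0 : 0 ≤ L s p.1 p.2 / M.lam p.1 p.2 (μ s) := div_nonneg (n1 _ _ _ hne) (by linarith)
      have hsc := tau_scale hx0 ha
      rw [mul_div_assoc]
      have hm0 : 0 ≤ μ s p.1 * M.lam p.1 p.2 (μ s) := mul_nonneg (hx.1 _) (by linarith)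
      have hm1 : μ s p.1 * M.lam p.1 p.2 (μ s) ≤ |M.Cb| :=
        (mul_le_of_le_one_left (by linarith) hle1).trans (hup.trans (le_abs_self _))
      have h1 := mul_le_mul_of_nonneg_left hsc hm0
      have h2 : a * (Real.log a * 2) * (μ s p.1 * M.lam p.1 p.2 (μ s)) ≤
        a * (Real.log a * 2) * |M.Cb| := mul_le_mul_of_nonneg_left hm1 (by positivity)
      linarith
    refine (setLIntegral_mono' measurableSet_Ioc key).trans ?_
    rw [lintegral_Ioc_scale (fun t => ENNReal.ofReal (1 + Real.log a) * ENNReal.ofReal (f t)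
          + ENNReal.ofReal K) _ ha0, lintegral_add_right _ measurable_const,
      lintegral_const_mul' _ _ ENNReal.ofReal_ne_top, lintegral_const]
    simp only [Measure.restrict_apply MeasurableSet.univ, univ_inter, Real.volume_Ioc, sub_zero]
    gcongr

lemma connect {r : ℕ} (hr : 0 < r) (M : MeanFieldModel r) {T : ℝ} (hT : 0 < T) {D : ℝ}
    (hD : 0 ≤ D) : ∃ A : ℝ, 0 ≤ A ∧ ∀ t, 0 < t → t ≤ T →
      ∀ ν ∈ stdSimplex ℝ (Fin r), ∀ ξ ∈ stdSimplex ℝ (Fin r), dist ν ξ ≤ D * t ^ 2 →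
        Reach M t ν ξ (ENNReal.ofReal (A * t)) := by
  obtain ⟨C, hC, W, Wc, W0, WE, WB, Wd⟩ := flux hr M
  have hcpos := M.c_pos
  have hr' : (0 : ℝ) < r := by exact_mod_cast hr
  obtain ⟨κ, hκ⟩ : ∃ κ : ℝ, κ = 1 / (1 + T ^ 2) := ⟨_, rfl⟩
  have hκ0 : 0 < κ := by rw [hκ]; positivity
  have hκ1 : κ ≤ 1 := by rw [hκ, div_le_one (by positivity)]; nlinarith
  have hκT : κ * T ^ 2 ≤ 1 := by
    rw [hκ, one_div, inv_mul_le_iff₀ (by positivity)]; linarith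
  obtain ⟨R, hR⟩ : ∃ R : ℝ, R = (C * (2 + 6 * D)) ^ 2 * r / (κ * M.c) := ⟨_, rfl⟩
  have hR0 : 0 ≤ R := by rw [hR]; positivity
  refine ⟨M.E.card * (R + |M.Cb|), by positivity, ?_⟩
  intro t ht htT ν hν ξ hξ hd
  obtain ⟨g, hg⟩ : ∃ g : ℝ → ℝ, g = fun s => s * (t - s) / t := ⟨_, rfl⟩
  obtain ⟨θ, hθ⟩ : ∃ θ : ℝ → ℝ, θ = fun s => 3 * (s / t) ^ 2 - 2 * (s / t) ^ 3 := ⟨_, rfl⟩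
  have hgd : ∀ s, HasDerivAt g (1 - 2 * (s / t)) s := by
    intro s
    rw [hg]
    have := ((hasDerivAt_id s).mul ((hasDerivAt_id s).const_sub t)).div_const t
    refine this.congr_deriv ?_
    simp only [id]; field_simp; ring
  have hθd : ∀ s, HasDerivAt θ (6 * g s / t ^ 2) s := by
    intro s
    rw [hθ, hg]
    have h0 := (hasDerivAt_id s).div_const t
    have := ((h0.pow 2).const_mul 3).sub ((h0.pow 3).const_mul 2)
    refine this.congr_deriv ?_
    simp only [id]; norm_num; field_simp; ring
  obtain ⟨l, hl⟩ : ∃ l : ℝ → Fin r → ℝ, l = fun s i => ν i + θ s * (ξ i - ν i) := ⟨_, rfl⟩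
  obtain ⟨μ, hμ⟩ : ∃ μ : ℝ → Fin r → ℝ, μ = fun s i =>
    (1 - κ * g s ^ 2) * l s i + κ * g s ^ 2 * (1 / r) := ⟨_, rfl⟩
  obtain ⟨v, hv⟩ : ∃ v : ℝ → Fin r → ℝ, v = fun s i =>
    2 * κ * g s * (1 - 2 * (s / t)) * (1 / r - l s i)
      + (1 - κ * g s ^ 2) * (6 * g s / t ^ 2 * (ξ i - ν i)) := ⟨_, rfl⟩
  have hμd : ∀ i s, HasDerivAt (fun s => μ s i) (v s i) s := by
    intro i s
    have hl' : HasDerivAt (fun s => l s i) (6 * g s / t ^ 2 * (ξ i - ν i)) s := by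
      rw [hl]; exact ((hθd s).mul_const _).const_add _
    have ha := ((hgd s).pow 2).const_mul κ
    rw [hμ, hv]
    have := ((ha.const_sub 1).mul hl').add (ha.mul_const (1 / (r : ℝ)))
    refine this.congr_deriv ?_
    simp only [Pi.pow_apply]; push_cast; ring
  have hgc : Continuous g := by rw [hg]; fun_prop
  have hθc : Continuous θ := by rw [hθ]; fun_prop
  have hlc : ∀ i, Continuous fun s => l s i := by intro i; rw [hl]; fun_prop
  have hμc : ∀ i, Continuous fun s => μ s i := by
    intro i; have := hlc i; rw [hμ]; fun_prop
  have hvc : ∀ i, Continuous fun s => v s i := by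
    intro i; have := hlc i; rw [hv]; fun_prop
  have hvc' : Continuous v := continuous_pi hvc
  -- bounds on [0,t]
  have hx01 : ∀ s ∈ Icc 0 t, 0 ≤ s / t ∧ s / t ≤ 1 := fun s hs =>
    ⟨div_nonneg hs.1 ht.le, (div_le_one ht).2 hs.2⟩
  have hg0 : ∀ s ∈ Icc 0 t, 0 ≤ g s := by
    intro s hs; rw [hg]
    exact div_nonneg (mul_nonneg hs.1 (by linarith [hs.2])) ht.le
  have hgT : ∀ s ∈ Icc 0 t, g s ≤ T := by
    intro s hs; rw [hg]
    refine le_trans ?_ htT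
    rw [div_le_iff₀ ht]
    exact mul_le_mul hs.2 (by linarith [hs.1]) (by linarith [hs.2]) ht.le
  have ha0 : ∀ s, 0 ≤ κ * g s ^ 2 := fun s => by positivity
  have ha1 : ∀ s ∈ Icc 0 t, κ * g s ^ 2 ≤ 1 := by
    intro s hs
    refine le_trans ?_ hκT
    have := pow_le_pow_left₀ (hg0 s hs) (hgT s hs) 2
    gcongr
  have hθ01 : ∀ s ∈ Icc 0 t, 0 ≤ θ s ∧ θ s ≤ 1 := by
    intro s hs
    obtain ⟨h0, h1⟩ := hx01 s hs
    simp only [hθ]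
    generalize s / t = x at *
    constructor
    · nlinarith [mul_nonneg (sq_nonneg x) (by linarith : 0 ≤ 3 - 2 * x)]
    · nlinarith [mul_nonneg (sq_nonneg (1 - x)) (by linarith : 0 ≤ 1 + 2 * x)]
  have hle1 : ∀ η ∈ stdSimplex ℝ (Fin r), ∀ i, η i ≤ 1 := by
    intro η hη i
    rw [← hη.2]; exact Finset.single_le_sum (fun i _ => hη.1 i) (Finset.mem_univ _)
  have hlsum : ∀ s, ∑ i, l s i = 1 := by
    intro s; rw [hl]
    simp only [Finset.sum_add_distrib, ← Finset.mul_sum, Finset.sum_sub_distrib, hν.2, hξ.2]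
    ring
  have husum : ∑ _i : Fin r, (1 / (r : ℝ)) = 1 := by
    simp [hr'.ne']
  have hlmem : ∀ s ∈ Icc 0 t, l s ∈ stdSimplex ℝ (Fin r) := by
    intro s hs
    obtain ⟨h0, h1⟩ := hθ01 s hs
    refine ⟨fun i => ?_, hlsum s⟩
    rw [hl]
    have := hν.1 i; have := hξ.1 i
    nlinarith [mul_nonneg h0 (hξ.1 i), mul_nonneg (sub_nonneg.2 h1) (hν.1 i)]
  have hμge : ∀ s ∈ Icc 0 t, ∀ i, κ * g s ^ 2 * (1 / r) ≤ μ s i := by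
    intro s hs i
    rw [hμ]
    have := mul_nonneg (sub_nonneg.2 (ha1 s hs)) ((hlmem s hs).1 i)
    simp only; linarith
  have hμmem : ∀ s ∈ Icc 0 t, μ s ∈ stdSimplex ℝ (Fin r) := by
    intro s hs
    refine ⟨fun i => le_trans (by positivity) (hμge s hs i), ?_⟩
    rw [hμ]
    simp only [Finset.sum_add_distrib, ← Finset.mul_sum, hlsum, husum]; ring
  have hvsum : ∀ s, ∑ i, v s i = 0 := by
    intro s; rw [hv]
    simp only [Finset.sum_add_distrib, ← Finset.mul_sum, Finset.sum_sub_distrib, hlsum, husum,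
      hν.2, hξ.2]
    ring
  have hvB : ∀ s ∈ Icc 0 t, ∀ i, |v s i| ≤ g s * (2 + 6 * D) := by
    intro s hs i
    have hg0' := hg0 s hs
    obtain ⟨h0, h1⟩ := hx01 s hs
    have hdi : |ξ i - ν i| ≤ D * t ^ 2 := by
      have := dist_le_pi_dist ν ξ i
      rw [Real.dist_eq, abs_sub_comm] at this
      exact this.trans hd
    have hu1 : 1 / (r : ℝ) ≤ 1 := by
      rw [div_le_one hr']; exact_mod_cast hr
    have hu0 : 0 ≤ 1 / (r : ℝ) := by positivity
    have b1 : |1 / r - l s i| ≤ 1 := by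
      have := (hlmem s hs).1 i
      have := hle1 _ (hlmem s hs) i
      rw [abs_le]; constructor <;> linarith
    have b2 : |1 - 2 * (s / t)| ≤ 1 := by rw [abs_le]; constructor <;> linarith
    have b3 : |1 - κ * g s ^ 2| ≤ 1 := by
      have := ha0 s; have := ha1 s hs
      rw [abs_le]; constructor <;> linarith
    rw [hv]
    refine (abs_add_le _ _).trans ?_
    have e1 : |2 * κ * g s * (1 - 2 * (s / t)) * (1 / r - l s i)| ≤ 2 * 1 * g s * 1 * 1 := by
      rw [abs_mul, abs_mul, abs_of_nonneg (by positivity : 0 ≤ 2 * κ * g s)]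
      gcongr
    have e2 : |(1 - κ * g s ^ 2) * (6 * g s / t ^ 2 * (ξ i - ν i))|
        ≤ 1 * (6 * g s / t ^ 2 * (D * t ^ 2)) := by
      rw [abs_mul, abs_mul, abs_of_nonneg (by positivity : 0 ≤ 6 * g s / t ^ 2)]
      gcongr
    have e3 : 1 * (6 * g s / t ^ 2 * (D * t ^ 2)) = 6 * g s * D := by field_simp
    rw [e3] at e2
    linarith
  have hWB : ∀ s ∈ Icc 0 t, ∀ i j, W (v s) i j ≤ C * (g s * (2 + 6 * D)) := fun s hs i j =>
    WB _ _ (hvB s hs) i j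
  have hWm : ∀ s ∈ Icc 0 t, ∀ i j, W (v s) i j ^ 2 ≤ R * (μ s i * M.c) := by
    intro s hs i j
    calc W (v s) i j ^ 2 ≤ (C * (g s * (2 + 6 * D))) ^ 2 :=
          pow_le_pow_left₀ (W0 _ _ _) (hWB s hs i j) 2
      _ = R * (κ * g s ^ 2 * (1 / r) * M.c) := by rw [hR]; field_simp
      _ ≤ _ := by
        have := hμge s hs i
        gcongr
  have hWz : ∀ s ∈ Icc 0 t, ∀ i j, W (v s) i j / μ s i * μ s i = W (v s) i j := by
    intro s hs i j
    rcases eq_or_ne (μ s i) 0 with h | h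
    · have := hWm s hs i j
      rw [h, zero_mul, mul_zero] at this
      have : W (v s) i j = 0 := by
        have := le_antisymm this (sq_nonneg _)
        exact pow_eq_zero_iff (two_ne_zero) |>.1 this
      simp [this]
    · exact div_mul_cancel₀ _ h
  have hWii : ∀ s i, W (v s) i i = 0 := fun s i => WE _ _ _ (M.no_diag i)
  obtain ⟨L, hL⟩ : ∃ L : ℝ → Fin r → Fin r → ℝ, L = fun s i j =>
    if i = j then -∑ k ∈ Finset.univ.filter (fun k => k ≠ i), |W (v s) i k / μ s i|
      else |W (v s) i j / μ s i| := ⟨_, rfl⟩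
  have hLne : ∀ s i j, i ≠ j → L s i j = |W (v s) i j / μ s i| := by
    intro s i j h; rw [hL]; simp [h]
  have hLii : ∀ s i, L s i i = -∑ k ∈ Finset.univ.filter (fun k => k ≠ i),
      |W (v s) i k / μ s i| := by
    intro s i; rw [hL]; simp
  have hμnn : ∀ s ∈ Icc 0 t, ∀ i, 0 ≤ μ s i := fun s hs i => (hμmem s hs).1 i
  have habs : ∀ s ∈ Icc 0 t, ∀ i j, |W (v s) i j / μ s i| = W (v s) i j / μ s i :=
    fun s hs i j => abs_of_nonneg (div_nonneg (W0 _ _ _) (hμnn s hs i))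
  have hmeas : ∀ i j, Measurable fun s => |W (v s) i j / μ s i| := by
    intro i j
    have h1 : Measurable fun s => W (v s) i j := ((Wc i j).comp hvc').measurable
    have h2 := (hμc i).measurable
    exact (h1.div h2).abs
  have hode : ∀ s ∈ Icc 0 t, ∀ i, ∑ j, L s j i * μ s j = v s i := by
    intro s hs i
    rw [← Wd (v s) (hvsum s) i, ← Finset.add_sum_erase _ _ (Finset.mem_univ i),
      ← Finset.add_sum_erase _ (fun j => W (v s) j i) (Finset.mem_univ i),
      ← Finset.add_sum_erase _ (fun j => W (v s) i j) (Finset.mem_univ i), hWii, hLii]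
    have e1 : ∑ j ∈ Finset.univ.erase i, L s j i * μ s j
        = ∑ j ∈ Finset.univ.erase i, W (v s) j i := by
      refine Finset.sum_congr rfl fun j hj => ?_
      rw [hLne s j i (Finset.ne_of_mem_erase hj), habs s hs, hWz s hs]
    have e2 : (∑ k ∈ Finset.univ.filter (fun k => k ≠ i), |W (v s) i k / μ s i|) * μ s i
        = ∑ j ∈ Finset.univ.erase i, W (v s) i j := by
      rw [Finset.sum_mul, Finset.filter_ne']
      refine Finset.sum_congr rfl fun j hj => ?_
      rw [habs s hs, hWz s hs]
    rw [e1, neg_mul, e2]; ring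
  refine ⟨μ, L, ⟨?_, ?_, ?_, ?_⟩, ⟨?_, ?_⟩, ?_, ?_, hμmem, ?_⟩
  · intro i j
    by_cases h : i = j
    · subst h
      simp only [hLii]
      exact (Finset.measurable_fun_sum _ fun k _ => hmeas i k).neg
    · simp only [hLne _ i j h]; exact hmeas i j
  · intro s i j h; rw [hLne s i j h]; exact abs_nonneg _
  · intro s i j h hE; rw [hLne s i j h, WE _ _ _ hE]; simp
  · intro s i
    rw [hLii]
    congr 1
    refine Finset.sum_congr rfl fun k hk => ?_
    rw [hLne s i k (Finset.mem_filter.1 hk).2.symm]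
  · intro i
    refine ((hvc i).integrableOn_Icc).congr_fun ?_ measurableSet_Icc
    intro s hs; exact (hode s hs i).symm
  · intro s hs i
    have : ∫ u in Ioc 0 s, ∑ j, L u j i * μ u j = ∫ u in Ioc 0 s, v u i :=
      setIntegral_congr_fun measurableSet_Ioc fun u hu =>
        hode u ⟨hu.1.le, hu.2.trans hs.2⟩ i
    rw [this, ← intervalIntegral.integral_of_le hs.1,
      intervalIntegral.integral_eq_sub_of_hasDerivAt (fun u _ => hμd i u)
        ((hvc i).intervalIntegrable _ _)]
    ring
  · ext i; rw [hμ, hl, hg, hθ]; simp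
  · ext i; rw [hμ, hl, hg, hθ]; simp only [div_self ht.ne', sub_self, mul_zero, zero_div]; ring
  · unfold runningCost
    have key : ∀ s ∈ Ioc 0 t, ENNReal.ofReal (∑ p ∈ M.E, μ s p.1 * M.lam p.1 p.2 (μ s)
        * tauStar (L s p.1 p.2 / M.lam p.1 p.2 (μ s) - 1))
        ≤ ENNReal.ofReal (M.E.card * (R + |M.Cb|)) := by
      intro s hs'
      have hs : s ∈ Icc 0 t := ⟨hs'.1.le, hs'.2⟩
      refine ENNReal.ofReal_le_ofReal ?_
      rw [← nsmul_eq_mul]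
      refine Finset.sum_le_card_nsmul _ _ _ fun p hp => ?_
      have hlam := M.lam_lower p hp _ (hμmem s hs)
      have hup := M.lam_upper p hp _ (hμmem s hs)
      have hne : p.1 ≠ p.2 := fun h => M.no_diag p.1 (by
        have : (p.1, p.1) = p := Prod.ext rfl h
        rwa [this])
      rw [hLne s _ _ hne, habs s hs]
      have hWz' := hWz s hs p.1 p.2
      have hWm' := hWm s hs p.1 p.2
      have hW0 := W0 (v s) p.1 p.2
      have hm0 := hμnn s hs p.1
      have hm1 := hle1 _ (hμmem s hs) p.1
      generalize M.lam p.1 p.2 (μ s) = lam at *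
      generalize W (v s) p.1 p.2 = w at *
      generalize μ s p.1 = m at *
      have hlp : 0 < lam := by linarith
      have hmc : m * lam ≤ |M.Cb| :=
        (mul_le_of_le_one_left hlp.le hm1).trans (hup.trans (le_abs_self _))
      rcases hm0.eq_or_lt with h | h
      · rw [← h]; simp; positivity
      · have hx0 : 0 ≤ w / m / lam := by positivity
        have h1 := mul_le_mul_of_nonneg_left (tau_le_sq hx0) (by positivity : 0 ≤ m * lam)
        have h2 : m * lam * (w / m / lam - 1) ^ 2 = w ^ 2 / (m * lam) - 2 * w + m * lam := by
          field_simp; ring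
        have h3 : w ^ 2 / (m * lam) ≤ R := by
          rw [div_le_iff₀ (by positivity)]
          refine hWm'.trans ?_
          gcongr
        linarith
    refine (setLIntegral_mono' measurableSet_Ioc key).trans ?_
    rw [setLIntegral_const, Real.volume_Ioc, sub_zero, ← ENNReal.ofReal_mul (by positivity)]

theorem stmt2_half {r : ℕ} (hr : 0 < r) (M : MeanFieldModel r) {T : ℝ} (hT : 0 < T) :
    ∀ ε : ℝ, 0 < ε → ∃ δ : ℝ, 0 < δ ∧
      ∀ ν₁ ∈ stdSimplex ℝ (Fin r), ∀ ξ₁ ∈ stdSimplex ℝ (Fin r),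
        ∀ ν₂ ∈ stdSimplex ℝ (Fin r), ∀ ξ₂ ∈ stdSimplex ℝ (Fin r),
          dist ν₁ ν₂ < δ → dist ξ₁ ξ₂ < δ →
            SEnd M T ν₁ ξ₁ ≤ SEnd M T ν₂ ξ₂ + ENNReal.ofReal ε := by
  intro ε hε
  obtain ⟨A, hA, hA'⟩ := connect hr M hT (D := 1) zero_le_one
  obtain ⟨B, hB, hB'⟩ := connect hr M hT (D := 1 / T ^ 2) (by positivity)
  obtain ⟨K, hK⟩ : ∃ K : ℝ, K = 2 * (M.E.card * |M.Cb|) * T := ⟨_, rfl⟩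
  have hK0 : 0 ≤ K := by rw [hK]; positivity
  obtain ⟨Q, hQ⟩ : ∃ Q : ℝ, Q = 2 * A + 4 / T * (B * T + 1 + K) + 1 := ⟨_, rfl⟩
  have hQ0 : 0 < Q := by rw [hQ]; positivity
  obtain ⟨h, hh⟩ : ∃ h : ℝ, h = min (T / 4) (ε / 2 / Q) := ⟨_, rfl⟩
  have hh0 : 0 < h := by rw [hh]; positivity
  have hhT : h ≤ T / 4 := by rw [hh]; exact min_le_left _ _
  have hhQ : h * Q ≤ ε / 2 := by
    rw [← le_div_iff₀ hQ0, hh]; exact min_le_right _ _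
  refine ⟨h ^ 2, by positivity, ?_⟩
  intro ν₁ hν₁ ξ₁ hξ₁ ν₂ hν₂ ξ₂ hξ₂ hdν hdξ
  -- uniform bound
  have hub : SEnd M T ν₂ ξ₂ ≤ ENNReal.ofReal (B * T) := by
    refine (hB' T hT le_rfl ν₂ hν₂ ξ₂ hξ₂ ?_).le
    rw [one_div, inv_mul_cancel₀ (by positivity)]
    refine (dist_pi_le_iff zero_le_one).2 fun i => ?_
    have a1 : ν₂ i ≤ 1 := by
      rw [← hν₂.2]; exact Finset.single_le_sum (fun i _ => hν₂.1 i) (Finset.mem_univ _)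
    have a2 : ξ₂ i ≤ 1 := by
      rw [← hξ₂.2]; exact Finset.single_le_sum (fun i _ => hξ₂.1 i) (Finset.mem_univ _)
    have := hν₂.1 i; have := hξ₂.1 i
    rw [Real.dist_eq, abs_le]; constructor <;> linarith
  have hfin : SEnd M T ν₂ ξ₂ ≠ ⊤ := ne_top_of_le_ne_top ENNReal.ofReal_ne_top hub
  obtain ⟨S, hS⟩ : ∃ S : ℝ, S = (SEnd M T ν₂ ξ₂).toReal := ⟨_, rfl⟩
  have hS0 : 0 ≤ S := by rw [hS]; exact ENNReal.toReal_nonneg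
  have hSe : SEnd M T ν₂ ξ₂ = ENNReal.ofReal S := by rw [hS, ENNReal.ofReal_toReal hfin]
  have hSB : S ≤ B * T := by
    rw [hSe] at hub; exact (ENNReal.ofReal_le_ofReal_iff (by positivity)).1 hub
  obtain ⟨e, he⟩ : ∃ e : ℝ, e = min 1 (ε / 2) := ⟨_, rfl⟩
  have he0 : 0 < e := by rw [he]; positivity
  have he1 : e ≤ 1 := by rw [he]; exact min_le_left _ _
  have he2 : e ≤ ε / 2 := by rw [he]; exact min_le_right _ _
  have hR : Reach M T ν₂ ξ₂ (ENNReal.ofReal (S + e)) := by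
    refine exists_reach ?_
    rw [hSe]; exact (ENNReal.ofReal_lt_ofReal_iff (by linarith)).2 (by linarith)
  have hT' : 0 < T - 2 * h := by linarith
  obtain ⟨a, ha⟩ : ∃ a : ℝ, a = T / (T - 2 * h) := ⟨_, rfl⟩
  have haT : a * (T - 2 * h) = T := by rw [ha]; field_simp
  have ha1 : 1 ≤ a := by rw [ha, one_le_div hT']; linarith
  have hla0 := Real.log_nonneg ha1
  have hla : Real.log a ≤ 4 / T * h := by
    refine (Real.log_le_sub_one_of_pos (by linarith)).trans ?_
    rw [ha, div_sub_one hT'.ne', div_mul_eq_mul_div, div_le_div_iff₀ hT' hT]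
    nlinarith
  rw [← haT] at hR
  have hR2 := hR.scale hT' ha1
  rw [haT] at hR2
  have hR1 := hA' h hh0 (by linarith) ν₁ hν₁ ν₂ hν₂ (by linarith)
  have hR3 := hA' h hh0 (by linarith) ξ₂ hξ₂ ξ₁ hξ₁ (by rw [dist_comm]; linarith)
  have hfinal := ((hR1.concat hh0.le hT' hR2).concat (by linarith) hh0 hR3).le
  rw [show h + (T - 2 * h) + h = T by ring] at hfinal
  refine hfinal.trans ?_
  have p1 : 0 ≤ 1 + Real.log a := by linarith
  have p2 : 0 ≤ Real.log a * 2 * (M.E.card * |M.Cb|) :=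
    mul_nonneg (mul_nonneg hla0 zero_le_two) (mul_nonneg (Nat.cast_nonneg _) (abs_nonneg _))
  have p3 : 0 ≤ A * h := by positivity
  have p4 : 0 ≤ (1 + Real.log a) * (S + e) := mul_nonneg p1 (by linarith)
  have p5 := mul_nonneg p2 hT.le
  rw [hSe, ← ENNReal.ofReal_add hS0 hε.le, ← ENNReal.ofReal_mul p1, ← ENNReal.ofReal_mul p2,
    ← ENNReal.ofReal_add p4 p5, ← ENNReal.ofReal_add p3 (add_nonneg p4 p5),
    ← ENNReal.ofReal_add (add_nonneg p3 (add_nonneg p4 p5)) p3]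
  refine ENNReal.ofReal_le_ofReal ?_
  have e1 : Real.log a * 2 * (M.E.card * |M.Cb|) * T = Real.log a * K := by rw [hK]; ring
  rw [e1]
  have e2 : Real.log a * (S + e + K) ≤ 4 / T * h * (B * T + 1 + K) := by
    gcongr
  have e3 : h * Q = 2 * A * h + 4 / T * h * (B * T + 1 + K) + h := by rw [hQ]; ring
  linarith

/-- for each fixed `T > 0`, the map `(ν, ξ) ↦ S_T(ξ|ν)` is
uniformly continuous on `M₁(Z) × M₁(Z)` (two-sided `ε`-closeness of the
`[0,∞]`-valued function under `δ`-closeness of the arguments). -/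
theorem stmt2 (r : ℕ) (hr : 0 < r) (M : MeanFieldModel r) (T : ℝ) (hT : 0 < T) :
    ∀ ε : ℝ, 0 < ε → ∃ δ : ℝ, 0 < δ ∧
      ∀ ν₁ ∈ stdSimplex ℝ (Fin r), ∀ ξ₁ ∈ stdSimplex ℝ (Fin r),
        ∀ ν₂ ∈ stdSimplex ℝ (Fin r), ∀ ξ₂ ∈ stdSimplex ℝ (Fin r),
          dist ν₁ ν₂ < δ → dist ξ₁ ξ₂ < δ →
            SEnd M T ν₁ ξ₁ ≤ SEnd M T ν₂ ξ₂ + ENNReal.ofReal ε ∧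
            SEnd M T ν₂ ξ₂ ≤ SEnd M T ν₁ ξ₁ + ENNReal.ofReal ε := by
  intro ε hε
  obtain ⟨δ, hδ, H⟩ := stmt2_half hr M hT ε hε
  refine ⟨δ, hδ, fun ν₁ hν₁ ξ₁ hξ₁ ν₂ hν₂ ξ₂ hξ₂ h1 h2 =>
    ⟨H ν₁ hν₁ ξ₁ hξ₁ ν₂ hν₂ ξ₂ hξ₂ h1 h2, H ν₂ hν₂ ξ₂ hξ₂ ν₁ hν₁ ξ₁ hξ₁ ?_ ?_⟩⟩
  · rwa [dist_comm]
  · rwa [dist_comm]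
end
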